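/- Assume relations (R1), (R2) and (R3) hold in R, assume e_{i,j}^N = 0 for all 1 ≤ i < j ≤ n+1, and assume R is generated as a k-algebra by x₁,…,xₙ. Then R is spanned as a k-vector space by the monomials e_{1,2}^{ε_{1,2}}·e_{1,3}^{ε_{1,3}}·⋯·e_{1,n+1}^{ε_{1,n+1}}·e_{2,3}^{ε_{2,3}}·⋯·e_{2,n+1}^{ε_{2,n+1}}·⋯·e_{n,n+1}^{ε_{n,n+1}}, where the product is taken over all pairs (i,j) with 1 ≤ i < j ≤ n+1 in lexicographic order and each exponent satisfies 0 ≤ ε_{i,j} ≤ N−1. (Lemma 'Lemma2.2.7'.) -/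

import Mathlib

/-- `B(i,j;p,r) = ∏_{i≤ℓ≤j−1} ∏_{p≤h≤r−1} q_{ℓ,h}`. -/
def Bq {k : Type*} [Field k] (qm : ℕ → ℕ → k) (i j p r : ℕ) : k :=
  ∏ l ∈ Finset.Ico i j, ∏ h ∈ Finset.Ico p r, qm l h

/-- The iterated braided commutators `e_{i,j}`: `e_{i,i+1} = x_i` and
`e_{i,j} = e_{i,j−1}·e_{j−1,j} − B(i,j−1;j−1,j)·e_{j−1,j}·e_{i,j−1}` for `j − i ≥ 2`. -/
def ee {k R : Type*} [Field k] [Ring R] [Algebra k R]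
    (qm : ℕ → ℕ → k) (x : ℕ → R) : ℕ → ℕ → R
  | i, j =>
    if _ : j ≤ i + 1 then x i
    else
      ee qm x i (j - 1) * ee qm x (j - 1) j
        - Bq qm i (j - 1) (j - 1) j • (ee qm x (j - 1) j * ee qm x i (j - 1))
  termination_by i j => j - i
  decreasing_by all_goals omega

/-- Two elements commute up to a nonzero scalar. -/
def QCommute (k : Type*) {R : Type*} [Field k] [Ring R] [Algebra k R] (u v : R) : Prop :=
  ∃ c : k, c ≠ 0 ∧ u * v = c • (v * u)

section QCommute

variable {k R : Type*} [Field k] [Ring R] [Algebra k R]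

theorem QCommute.symm {u v : R} (h : QCommute k u v) : QCommute k v u := by
  obtain ⟨c, hc, h⟩ := h
  exact ⟨c⁻¹, inv_ne_zero hc, by rw [h, smul_smul, inv_mul_cancel₀ hc, one_smul]⟩

theorem QCommute.braided_left {u v y : R} (hu : QCommute k u y) (hv : QCommute k v y) (β : k) :
    QCommute k (u * v - β • (v * u)) y := by
  obtain ⟨c, hc, hu⟩ := hu
  obtain ⟨d, hd, hv⟩ := hv
  refine ⟨c * d, mul_ne_zero hc hd, ?_⟩
  have h1 : u * v * y = (c * d) • (y * (u * v)) := by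
    rw [mul_assoc, hv, mul_smul_comm, ← mul_assoc, hu, smul_mul_assoc, smul_smul, mul_assoc,
      mul_comm d c]
  have h2 : v * u * y = (c * d) • (y * (v * u)) := by
    rw [mul_assoc, hu, mul_smul_comm, ← mul_assoc, hv, smul_mul_assoc, smul_smul, mul_assoc]
  rw [sub_mul, smul_mul_assoc, h1, h2, mul_sub, mul_smul_comm, smul_sub, smul_comm]

theorem QCommute.exists_mul_pow {x e : R} (h : QCommute k x e) (m : ℕ) :
    ∃ c : k, x * e ^ m = c • (e ^ m * x) := by
  obtain ⟨c, -, h⟩ := h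
  refine ⟨c ^ m, ?_⟩
  induction m with
  | zero => simp
  | succ m ih =>
    rw [pow_succ, ← mul_assoc, ih, smul_mul_assoc, mul_assoc, h, mul_smul_comm, smul_smul,
      mul_assoc, pow_succ]

/-- The associativity of braided commutators when the outer terms commute up to a scalar. -/
theorem braided_commutator_assoc {u v w : R} {α β γ : k} (h : u * w = γ • (w * u)) :
    u * (v * w - β • (w * v)) - (α * γ) • ((v * w - β • (w * v)) * u)
      = (u * v - α • (v * u)) * w - (γ * β) • (w * (u * v - α • (v * u))) := by
  have h1 : u * (w * v) = γ • (w * (u * v)) := by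
    rw [← mul_assoc, h, smul_mul_assoc, mul_assoc]
  have h2 : v * (u * w) = γ • (v * (w * u)) := by rw [h, mul_smul_comm]
  simp only [mul_sub, sub_mul, smul_mul_assoc, mul_smul_comm, mul_assoc, h1, h2]
  module

/-- In type `A₃`, the longest braided commutator commutes up to a scalar with the middle
generator. -/
theorem braided_commutator_middle {u v w : R} {q α γ δ : k} (hα : α ≠ 0) (hδ : δ ≠ 0)
    (hq : q + 1 ≠ 0) (huw : u * w = γ • (w * u))
    (hvw : v * (v * w - δ • (w * v)) = (q * δ) • ((v * w - δ • (w * v)) * v))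
    (huv : (u * v - α • (v * u)) * v = (α * q) • (v * (u * v - α • (v * u)))) :
    QCommute k ((u * v - α • (v * u)) * w - (γ * δ) • (w * (u * v - α • (v * u)))) v := by
  have hJ := braided_commutator_assoc (v := v) (α := α) (β := δ) huw
  generalize hE : (u * v - α • (v * u)) * w - (γ * δ) • (w * (u * v - α • (v * u))) = E at hJ ⊢
  generalize ha : u * v - α • (v * u) = a at hE huv
  generalize hb : v * w - δ • (w * v) = b at hJ hvw
  have huv' : u * v = a + α • (v * u) := by rw [← ha]; abel
  have hvw' : v * w = b + δ • (w * v) := by rw [← hb]; abel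
  have key1 : (q * δ) • (E * v)
      = a * b - (α * γ * q * δ) • (b * a) + α • (v * E) := by
    have e1 : (q * δ) • (u * (b * v)) = a * b + α • (v * (u * b)) := by
      rw [← mul_smul_comm, ← hvw, ← mul_assoc, huv', add_mul, smul_mul_assoc, mul_assoc]
    have e2 : b * (u * v) = b * a + α • (b * (v * u)) := by
      rw [huv', mul_add, mul_smul_comm]
    have e3 : v * (b * u) = (q * δ) • (b * (v * u)) := by
      rw [← mul_assoc, hvw, smul_mul_assoc, mul_assoc]
    simp only [← hJ, mul_sub, sub_mul, smul_mul_assoc, mul_smul_comm, mul_assoc, e2, e3,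
      smul_sub, e1]
    module
  have key2 : (α * q) • (v * E)
      = a * b - (α * γ * q * δ) • (b * a) + δ • (E * v) := by
    have e1 : (α * q) • (v * (a * w)) = a * b + δ • (a * (w * v)) := by
      rw [← mul_assoc, ← smul_mul_assoc, ← huv, mul_assoc, hvw', mul_add, mul_smul_comm]
    have e2 : v * (w * a) = b * a + δ • (w * (v * a)) := by
      rw [← mul_assoc, hvw', add_mul, smul_mul_assoc, mul_assoc]
    simp only [← hE, mul_sub, sub_mul, smul_mul_assoc, mul_smul_comm, mul_assoc, e2, huv,
      smul_sub, e1]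
    module
  have key : (q + 1) • (δ • (E * v) - α • (v * E)) = 0 := by
    linear_combination (norm := module) key1 - key2
  have h0 := (smul_eq_zero.mp key).resolve_left hq
  refine ⟨δ⁻¹ * α, mul_ne_zero (inv_ne_zero hδ) hα, ?_⟩
  rw [mul_smul, ← sub_eq_zero.mp h0, smul_smul, inv_mul_cancel₀ hδ, one_smul]

theorem exists_mul_pow_succ_of_mul_eq {x e f : R} {c d : k}
    (h : x * e = c • (e * x) + d • f) (hef : QCommute k f e) (m : ℕ) :
    ∃ c' d' : k, x * e ^ (m + 1) = c' • (e ^ (m + 1) * x) + d' • (e ^ m * f) := by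
  obtain ⟨s, -, hs⟩ := hef
  induction m with
  | zero => exact ⟨c, d, by simpa using h⟩
  | succ m ih =>
    obtain ⟨c', d', ih⟩ := ih
    refine ⟨c' * c, c' * d + d' * s, ?_⟩
    have h1 : e ^ (m + 1) * (x * e) = c • (e ^ (m + 2) * x) + d • (e ^ (m + 1) * f) := by
      rw [h, mul_add, mul_smul_comm, mul_smul_comm, ← mul_assoc, ← pow_succ]
    have h2 : e ^ m * (f * e) = s • (e ^ (m + 1) * f) := by
      rw [hs, mul_smul_comm, ← mul_assoc, ← pow_succ]
    rw [pow_succ e (m + 1), ← mul_assoc, ih, add_mul, smul_mul_assoc, smul_mul_assoc, mul_assoc,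
      mul_assoc, h1, h2, ← pow_succ]
    module

end QCommute

section PowerSpan

variable (k : Type*) {R : Type*} [Field k] [Ring R] [Algebra k R]

/-- The span of the powers of an element. -/
def powerSpan (e : R) : Submodule k R := Submodule.span k (Set.range fun m : ℕ => e ^ m)

variable {k}

theorem pow_mem_powerSpan (e : R) (m : ℕ) : e ^ m ∈ powerSpan k e :=
  Submodule.subset_span ⟨m, rfl⟩

theorem one_le_powerSpan (e : R) : 1 ≤ powerSpan k e :=
  Submodule.one_le.mpr (by simpa using pow_mem_powerSpan (k := k) e 0)

theorem mul_powerSpan_le {A M : Submodule k R} {e : R} (h : ∀ a ∈ A, ∀ m : ℕ, a * e ^ m ∈ M) :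
    A * powerSpan k e ≤ M := by
  refine Submodule.mul_le.mpr fun a ha b hb => ?_
  induction hb using Submodule.span_induction with
  | mem b hb => obtain ⟨m, rfl⟩ := hb; exact h a ha m
  | zero => simp
  | add b c _ _ hb hc => rw [mul_add]; exact add_mem hb hc
  | smul s b _ hb => rw [mul_smul_comm]; exact M.smul_mem s hb

theorem span_one_pair_mul_powerSpan_le {M : Submodule k R} {x e : R} (h1 : powerSpan k e ≤ M)
    (hx : ∀ m : ℕ, x * e ^ m ∈ M) : Submodule.span k {1, x} * powerSpan k e ≤ M := by
  refine mul_powerSpan_le fun a ha m => ?_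
  obtain ⟨s, t, rfl⟩ := Submodule.mem_span_pair.mp ha
  rw [add_mul, smul_mul_assoc, smul_mul_assoc, one_mul]
  exact add_mem (M.smul_mem s (h1 (pow_mem_powerSpan e m))) (M.smul_mem t (hx m))

theorem one_le_span_one_pair (x : R) : 1 ≤ Submodule.span k {1, x} :=
  Submodule.one_le.mpr (Submodule.subset_span (by simp))

theorem span_one_pair_mul_powerSpan_self (x : R) :
    Submodule.span k {1, x} * powerSpan k x ≤ powerSpan k x :=
  span_one_pair_mul_powerSpan_le le_rfl fun m => by
    rw [← pow_succ']; exact pow_mem_powerSpan x (m + 1)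

theorem QCommute.span_one_pair_mul_powerSpan {x e : R} (h : QCommute k x e) :
    Submodule.span k {1, x} * powerSpan k e ≤ powerSpan k e * Submodule.span k {1, x} := by
  refine span_one_pair_mul_powerSpan_le (le_mul_of_one_le_right' (one_le_span_one_pair x))
    fun m => ?_
  obtain ⟨c, hc⟩ := h.exists_mul_pow m
  rw [hc]
  exact Submodule.smul_mem _ c
    (Submodule.mul_mem_mul (pow_mem_powerSpan e m) (Submodule.subset_span (by simp)))

theorem span_one_pair_mul_powerSpan_mul_powerSpan {x e f : R} {c d : k}
    (h : x * e = c • (e * x) + d • f) (hef : QCommute k f e) (hxf : QCommute k x f) :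
    Submodule.span k {1, x} * (powerSpan k e * powerSpan k f)
      ≤ powerSpan k e * powerSpan k f * Submodule.span k {1, x} := by
  have h1 : Submodule.span k {1, x} * powerSpan k e
      ≤ powerSpan k e * (Submodule.span k {1, x} ⊔ Submodule.span k {1, f}) := by
    refine span_one_pair_mul_powerSpan_le
      (le_mul_of_one_le_right' ((one_le_span_one_pair x).trans le_sup_left)) fun m => ?_
    have hx : x ∈ Submodule.span k {1, x} ⊔ Submodule.span k {1, f} :=
      le_sup_left (a := Submodule.span k {1, x}) (Submodule.subset_span (by simp))
    have hf : f ∈ Submodule.span k {1, x} ⊔ Submodule.span k {1, f} :=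
      le_sup_right (b := Submodule.span k {1, f}) (Submodule.subset_span (by simp))
    cases m with
    | zero => simpa using Submodule.mul_mem_mul (pow_mem_powerSpan e 0) hx
    | succ m =>
      obtain ⟨c', d', h'⟩ := exists_mul_pow_succ_of_mul_eq h hef m
      rw [h']
      exact add_mem
        (Submodule.smul_mem _ _ (Submodule.mul_mem_mul (pow_mem_powerSpan e (m + 1)) hx))
        (Submodule.smul_mem _ _ (Submodule.mul_mem_mul (pow_mem_powerSpan e m) hf))
  rw [← mul_assoc]
  refine (mul_le_mul_left h1 _).trans ?_
  rw [mul_assoc, mul_assoc]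
  refine mul_le_mul_right ?_ _
  rw [Submodule.sup_mul]
  exact sup_le hxf.span_one_pair_mul_powerSpan
    ((span_one_pair_mul_powerSpan_self f).trans
      (le_mul_of_one_le_right' (one_le_span_one_pair x)))

/-- A product of spans of powers is spanned by the corresponding monomials. -/
theorem prod_powerSpan_le_span {ι : Type*} (e : ι → R) {l : List ι} (hl : l.Nodup) :
    (l.map fun a => powerSpan k (e a)).prod
      ≤ Submodule.span k {m | ∃ ε : ι → ℕ, m = (l.map fun a => e a ^ ε a).prod} := by
  classical
  induction l with
  | nil =>
    rw [List.map_nil, List.prod_nil, Submodule.one_le]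
    exact Submodule.subset_span ⟨fun _ => 0, by simp⟩
  | cons a l ih =>
    obtain ⟨ha, hl⟩ := List.nodup_cons.mp hl
    rw [List.map_cons, List.prod_cons]
    refine (mul_le_mul_right (ih hl) _).trans ?_
    rw [powerSpan, Submodule.span_mul_span, Submodule.span_le]
    rintro _ ⟨_, ⟨m, rfl⟩, _, ⟨ε, rfl⟩, rfl⟩
    refine Submodule.subset_span ⟨Function.update ε a m, ?_⟩
    rw [List.map_cons, List.prod_cons, Function.update_self]
    congr 2
    refine List.map_congr_left fun b hb => ?_
    rw [Function.update_of_ne (ne_of_mem_of_not_mem hb ha)]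

end PowerSpan

section OrderedSemiring

variable {M : Type*} [Semiring M] [PartialOrder M] [MulLeftMono M] [MulRightMono M]

theorem mul_mul_le_of_commute_le {y a b : M} (ha : y * a ≤ a * y) (hb : y * b ≤ b * y) :
    y * (a * b) ≤ a * b * y := by
  calc y * (a * b) = y * a * b := (mul_assoc _ _ _).symm
    _ ≤ a * y * b := mul_le_mul_left ha b
    _ = a * (y * b) := mul_assoc _ _ _
    _ ≤ a * (b * y) := mul_le_mul_right hb a
    _ = a * b * y := (mul_assoc _ _ _).symm

theorem mul_prod_range_le {y : M} {P : ℕ → M} {m : ℕ} (h : ∀ r < m, y * P r ≤ P r * y) :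
    y * ((List.range m).map P).prod ≤ ((List.range m).map P).prod * y := by
  induction m with
  | zero => simp
  | succ m ih =>
    rw [List.range_succ, List.map_append, List.prod_append, List.map_singleton,
      List.prod_singleton]
    exact mul_mul_le_of_commute_le (ih fun r hr => h r (by omega)) (h m (by omega))

theorem mul_prod_range_le_of_pair {y : M} {P : ℕ → M} {d m : ℕ} (hm : d + 2 ≤ m)
    (h : ∀ r < m, r ≠ d → r ≠ d + 1 → y * P r ≤ P r * y)
    (hd : y * (P d * P (d + 1)) ≤ P d * P (d + 1) * y) :
    y * ((List.range m).map P).prod ≤ ((List.range m).map P).prod * y := by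
  induction m, hm using Nat.le_induction with
  | base =>
    simp only [List.range_succ (n := d + 1), List.range_succ (n := d), List.map_append,
      List.prod_append, List.map_singleton, List.prod_singleton]
    rw [mul_assoc (List.prod _)]
    refine mul_mul_le_of_commute_le (mul_prod_range_le fun r hr => ?_) hd
    exact h r (by omega) (by omega) (by omega)
  | succ m hm ih =>
    rw [List.range_succ, List.map_append, List.prod_append, List.map_singleton,
      List.prod_singleton]
    exact mul_mul_le_of_commute_le (ih fun r hr => h r (by omega))
      (h m (by omega) (by omega) (by omega))

theorem mul_prod_range_le_self {y : M} {P : ℕ → M} {d m : ℕ} (hm : d + 1 ≤ m)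
    (h : ∀ r < d, y * P r ≤ P r * y) (hd : y * P d ≤ P d) :
    y * ((List.range m).map P).prod ≤ ((List.range m).map P).prod := by
  induction m, hm using Nat.le_induction with
  | base =>
    rw [List.range_succ, List.map_append, List.prod_append, List.map_singleton,
      List.prod_singleton, ← mul_assoc]
    refine (mul_le_mul_left (mul_prod_range_le h) _).trans ?_
    rw [mul_assoc]
    exact mul_le_mul_right hd _
  | succ m hm ih =>
    rw [List.range_succ, List.map_append, List.prod_append, List.map_singleton,
      List.prod_singleton, ← mul_assoc]
    exact mul_le_mul_left ih _

end OrderedSemiring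

section RootVectors

variable {k R : Type*} [Field k] [Ring R] [Algebra k R] {qm : ℕ → ℕ → k} {x : ℕ → R}

theorem ee_self_succ (qm : ℕ → ℕ → k) (x : ℕ → R) (i : ℕ) : ee qm x i (i + 1) = x i := by
  rw [ee, dif_pos le_rfl]

theorem ee_succ (qm : ℕ → ℕ → k) (x : ℕ → R) {i j : ℕ} (h : i < j) :
    ee qm x i (j + 1)
      = ee qm x i j * x j - Bq qm i j j (j + 1) • (x j * ee qm x i j) := by
  rw [ee, dif_neg (by omega), Nat.add_sub_cancel, ee_self_succ]

theorem Bq_ne_zero {n : ℕ} (hqne : ∀ i j, 1 ≤ i → i ≤ n → 1 ≤ j → j ≤ n → qm i j ≠ 0)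
    {i j p r : ℕ} (hi : 1 ≤ i) (hj : j ≤ n + 1) (hp : 1 ≤ p) (hr : r ≤ n + 1) :
    Bq qm i j p r ≠ 0 := by
  refine Finset.prod_ne_zero_iff.mpr fun l hl => Finset.prod_ne_zero_iff.mpr fun h hh => ?_
  rw [Finset.mem_Ico] at hl hh
  exact hqne l h (by omega) (by omega) (by omega) (by omega)

theorem Bq_succ_left {i j : ℕ} (h : i ≤ j) (p r : ℕ) :
    Bq qm i (j + 1) p r = Bq qm i j p r * Bq qm j (j + 1) p r := by
  rw [Bq, Bq, Bq, Finset.prod_Ico_succ_top h, Nat.Ico_succ_singleton, Finset.prod_singleton]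

theorem Bq_succ_right (i j : ℕ) {p r : ℕ} (h : p ≤ r) :
    Bq qm i j p (r + 1) = Bq qm i j p r * Bq qm i j r (r + 1) := by
  simp only [Bq, ← Finset.prod_mul_distrib]
  refine Finset.prod_congr rfl fun l _ => ?_
  rw [Finset.prod_Ico_succ_top h, Nat.Ico_succ_singleton, Finset.prod_singleton]

theorem Bq_mul_Bq {i j r : ℕ} (hij : i ≤ j) (hjr : j ≤ r) (p s : ℕ) :
    Bq qm i j p s * Bq qm j r p s = Bq qm i r p s :=
  Finset.prod_Ico_consecutive _ hij hjr

@[simp]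
theorem Bq_singleton (i p : ℕ) : Bq qm i (i + 1) p (p + 1) = qm i p := by
  simp [Bq]

theorem ee_mul_of_lt {n : ℕ}
    (R1 : ∀ i p, 1 ≤ i → i < p → p ≤ n → i + 2 ≤ p → x i * x p = qm i p • (x p * x i))
    {a r i : ℕ} (ha : 1 ≤ a) (har : a < r) (hri : r < i) (hi : i ≤ n) :
    ee qm x a r * x i = Bq qm a r i (i + 1) • (x i * ee qm x a r) := by
  induction r, har using Nat.le_induction with
  | base =>
    rw [Nat.succ_eq_add_one, ee_self_succ, Bq_singleton]
    exact R1 a i ha (by omega) hi (by omega)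
  | succ r har ih =>
    have hr := ih (by omega)
    have hx := R1 r i (by omega) (by omega) hi (by omega)
    rw [ee_succ qm x har, Bq_succ_left (by omega), Bq_singleton]
    generalize ee qm x a r = u at *
    generalize Bq qm a r i (i + 1) = c at *
    have h1 : u * (x r * x i) = (qm r i * c) • (x i * (u * x r)) := by
      rw [hx, mul_smul_comm, ← mul_assoc, hr, smul_mul_assoc, smul_smul, mul_assoc]
    have h2 : x r * (u * x i) = (qm r i * c) • (x i * (x r * u)) := by
      rw [hr, mul_smul_comm, ← mul_assoc, hx, smul_mul_assoc, smul_smul, mul_assoc, mul_comm c]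
    simp only [sub_mul, mul_sub, smul_mul_assoc, mul_smul_comm, mul_assoc, h1, h2]
    module

theorem ee_eq_braided_commutator {n : ℕ}
    (R1 : ∀ i p, 1 ≤ i → i < p → p ≤ n → i + 2 ≤ p → x i * x p = qm i p • (x p * x i))
    {a j r : ℕ} (ha : 1 ≤ a) (haj : a < j) (hjr : j < r) (hr : r ≤ n + 1) :
    ee qm x a r = ee qm x a j * ee qm x j r - Bq qm a j j r • (ee qm x j r * ee qm x a j) := by
  induction r, hjr using Nat.le_induction with
  | base => rw [Nat.succ_eq_add_one, ee_succ qm x haj, ee_self_succ]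
  | succ r hjr ih =>
    rw [ee_succ qm x (by omega : a < r), ih (by omega), ee_succ qm x hjr,
      Bq_succ_right a j (by omega : j ≤ r), ← Bq_mul_Bq haj.le (by omega : j ≤ r) r (r + 1)]
    exact (braided_commutator_assoc (ee_mul_of_lt R1 ha haj hjr (by omega))).symm

variable {n : ℕ} {q : k}
  (hqne : ∀ i j, 1 ≤ i → i ≤ n → 1 ≤ j → j ≤ n → qm i j ≠ 0)
  (R1 : ∀ i p, 1 ≤ i → i < p → p ≤ n → i + 2 ≤ p → x i * x p = qm i p • (x p * x i))
  (R2 : ∀ i, 1 ≤ i → i < n →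
    ee qm x i (i+1) * ee qm x i (i+2)
      = Bq qm i (i+1) i (i+2) • (ee qm x i (i+2) * ee qm x i (i+1)))
  (R3 : ∀ i, 1 ≤ i → i < n →
    ee qm x i (i+2) * ee qm x (i+1) (i+2)
      = Bq qm i (i+2) (i+1) (i+2) • (ee qm x (i+1) (i+2) * ee qm x i (i+2)))

include hqne R1

theorem qCommute_ee_of_lt {a r i : ℕ} (ha : 1 ≤ a) (har : a < r) (hri : r < i) (hi : i ≤ n) :
    QCommute k (ee qm x a r) (x i) :=
  ⟨_, Bq_ne_zero hqne ha (by omega) (by omega) (by omega), ee_mul_of_lt R1 ha har hri hi⟩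

include R3

theorem qCommute_ee_succ {a i : ℕ} (ha : 1 ≤ a) (hai : a < i) (hi : i ≤ n) :
    QCommute k (ee qm x a (i + 1)) (x i) := by
  have base (j : ℕ) (hj : 1 ≤ j) (hjn : j + 1 ≤ n) :
      QCommute k (ee qm x j (j + 2)) (x (j + 1)) := by
    refine ⟨Bq qm j (j + 2) (j + 1) (j + 2),
      Bq_ne_zero hqne hj (by omega) (by omega) (by omega), ?_⟩
    simpa only [ee_self_succ] using R3 j hj (by omega)
  obtain ⟨j, rfl⟩ : ∃ j, i = j + 1 := ⟨i - 1, by omega⟩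
  obtain rfl | haj := (Nat.lt_succ_iff.mp hai).eq_or_lt
  · exact base a ha hi
  · rw [ee_eq_braided_commutator R1 ha haj (by omega : j < j + 1 + 1) (by omega)]
    exact (qCommute_ee_of_lt hqne R1 ha haj (by omega) hi).braided_left
      (base j (by omega) hi) _

include R2

theorem qCommute_ee_add_two (hdiag : ∀ i, 1 ≤ i → i ≤ n → qm i i = q) (hq : q + 1 ≠ 0)
    {a i : ℕ} (ha : 1 ≤ a) (hai : a < i) (hi : i + 1 ≤ n) :
    QCommute k (ee qm x a (i + 2)) (x i) := by
  have base (j : ℕ) (hj : 1 ≤ j) (hjn : j + 2 ≤ n) :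
      QCommute k (ee qm x j (j + 3)) (x (j + 1)) := by
    have h2 := R2 (j + 1) (by omega) (by omega)
    have h3 := R3 j hj (by omega)
    rw [ee_self_succ, ee_succ qm x (by omega : j + 1 < j + 2), ee_self_succ, Bq_singleton,
      Bq_succ_right _ _ (by omega : j + 1 ≤ j + 2), Bq_singleton, Bq_singleton,
      hdiag _ (by omega) (by omega)] at h2
    rw [ee_self_succ, ee_succ qm x (by omega : j < j + 1), ee_self_succ, Bq_singleton,
      Bq_succ_left (by omega : j ≤ j + 1), Bq_singleton, Bq_singleton,
      hdiag _ (by omega) (by omega)] at h3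
    rw [ee_succ qm x (by omega : j < j + 2), ee_succ qm x (by omega : j < j + 1), ee_self_succ,
      Bq_singleton, Bq_succ_left (by omega : j ≤ j + 1), Bq_singleton, Bq_singleton]
    exact braided_commutator_middle (hqne _ _ hj (by omega) (by omega) (by omega))
      (hqne _ _ (by omega) (by omega) (by omega) (by omega)) hq
      (R1 j (j + 2) hj (by omega) hjn le_rfl) h2 h3
  obtain ⟨j, rfl⟩ : ∃ j, i = j + 1 := ⟨i - 1, by omega⟩
  obtain rfl | haj := (Nat.lt_succ_iff.mp hai).eq_or_lt
  · exact base a ha hi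
  · rw [ee_eq_braided_commutator R1 ha haj (by omega : j < j + 1 + 2) (by omega)]
    exact (qCommute_ee_of_lt hqne R1 ha haj (by omega) (by omega)).braided_left
      (base j (by omega) hi) _

theorem qCommute_ee_of_gt (hdiag : ∀ i, 1 ≤ i → i ≤ n → qm i i = q) (hq : q + 1 ≠ 0)
    {a i r : ℕ} (ha : 1 ≤ a) (hai : a < i) (hir : i + 2 ≤ r) (hr : r ≤ n + 1) :
    QCommute k (ee qm x a r) (x i) := by
  induction r, hir using Nat.le_induction with
  | base => exact qCommute_ee_add_two hqne R1 R2 R3 hdiag hq ha hai (by omega)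
  | succ r hir ih =>
    rw [ee_succ qm x (by omega : a < r)]
    refine (ih (by omega)).braided_left (QCommute.symm ⟨qm i r, ?_, ?_⟩) _
    · exact hqne _ _ (by omega) (by omega) (by omega) (by omega)
    · exact R1 i r (by omega) (by omega) (by omega) hir

theorem qCommute_ee_ee_succ (hdiag : ∀ i, 1 ≤ i → i ≤ n → qm i i = q) (hq : q + 1 ≠ 0)
    {a r : ℕ} (ha : 1 ≤ a) (har : a < r) (hr : r ≤ n) :
    QCommute k (ee qm x a (r + 1)) (ee qm x a r) := by
  induction r, har using Nat.le_induction with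
  | base =>
    exact QCommute.symm ⟨_, Bq_ne_zero hqne ha (by omega) ha (by omega), R2 a ha (by omega)⟩
  | succ r har ih =>
    refine QCommute.symm ?_
    have h : QCommute k (ee qm x a (r + 2)) (ee qm x a r) := by
      rw [ee_succ qm x (by omega : a < r + 1)]
      exact (ih (by omega)).braided_left
        (qCommute_ee_of_lt hqne R1 ha har (by omega) hr).symm _
    have h' : QCommute k (ee qm x a (r + 2)) (x r) := by
      exact qCommute_ee_add_two hqne R1 R2 R3 hdiag hq ha har hr
    rw [ee_succ qm x har]
    exact h.symm.braided_left h'.symm _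

theorem span_one_pair_mul_row_le (hdiag : ∀ i, 1 ≤ i → i ≤ n → qm i i = q) (hq : q + 1 ≠ 0)
    {a i : ℕ} (ha : 1 ≤ a) (hai : a < i) (hi : i ≤ n) :
    Submodule.span k {1, x i}
        * ((List.range (n + 1 - a)).map fun d => powerSpan k (ee qm x a (a + 1 + d))).prod
      ≤ ((List.range (n + 1 - a)).map fun d => powerSpan k (ee qm x a (a + 1 + d))).prod
        * Submodule.span k {1, x i} := by
  refine mul_prod_range_le_of_pair (d := i - (a + 1)) (by omega) (fun d hd hne hne' => ?_) ?_
  · refine (QCommute.symm ?_).span_one_pair_mul_powerSpan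
    obtain h | h : a + 1 + d < i ∨ i + 2 ≤ a + 1 + d := by omega
    · exact qCommute_ee_of_lt hqne R1 ha (by omega) h hi
    · exact qCommute_ee_of_gt hqne R1 R2 R3 hdiag hq ha hai h (by omega)
  · rw [show a + 1 + (i - (a + 1)) = i by omega, show a + 1 + (i - (a + 1) + 1) = i + 1 by omega]
    have hB : Bq qm a i i (i + 1) ≠ 0 :=
      Bq_ne_zero hqne ha (by omega) (by omega) (by omega)
    refine span_one_pair_mul_powerSpan_mul_powerSpan (c := (Bq qm a i i (i + 1))⁻¹)
      (d := -(Bq qm a i i (i + 1))⁻¹) ?_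
      (qCommute_ee_ee_succ hqne R1 R2 R3 hdiag hq ha hai hi)
      (qCommute_ee_succ hqne R1 R3 ha hai hi).symm
    rw [ee_succ qm x hai, smul_sub, neg_smul, neg_smul, smul_smul, inv_mul_cancel₀ hB, one_smul]
    abel

theorem span_one_pair_mul_rows_le (hdiag : ∀ i, 1 ≤ i → i ≤ n → qm i i = q) (hq : q + 1 ≠ 0)
    {i : ℕ} (hi : 1 ≤ i) (hin : i ≤ n) :
    Submodule.span k {1, x i}
        * ((List.range n).map fun a => ((List.range (n - a)).map fun d =>
            powerSpan k (ee qm x (a + 1) (a + 2 + d))).prod).prod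
      ≤ ((List.range n).map fun a => ((List.range (n - a)).map fun d =>
            powerSpan k (ee qm x (a + 1) (a + 2 + d))).prod).prod := by
  obtain ⟨i, rfl⟩ : ∃ j, i = j + 1 := ⟨i - 1, by omega⟩
  refine mul_prod_range_le_self (d := i) hin (fun a ha => ?_) ?_
  · have h := span_one_pair_mul_row_le hqne R1 R2 R3 hdiag hq (by omega : 1 ≤ a + 1)
      (by omega : a + 1 < i + 1) hin
    rwa [Nat.add_sub_add_right] at h
  · refine mul_prod_range_le_self (d := 0) (by omega) (fun a ha => absurd ha (by omega)) ?_
    rw [add_zero, ee_self_succ]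
    exact span_one_pair_mul_powerSpan_self _

end RootVectors

/-- A subspace containing `1` and stable under left multiplication by generators of the algebra
is everything. -/
theorem Submodule.eq_top_of_adjoin_eq_top {k R : Type*} [Field k] [Ring R] [Algebra k R]
    {s : Set R} (hs : Algebra.adjoin k s = ⊤) {M : Submodule k R} (h1 : (1 : R) ∈ M)
    (h : ∀ a ∈ s, ∀ m ∈ M, a * m ∈ M) : M = ⊤ := by
  have key (a : R) : ∀ m ∈ M, a * m ∈ M := by
    have ha : a ∈ Algebra.adjoin k s := hs ▸ Algebra.mem_top
    induction ha using Algebra.adjoin_induction with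
    | mem a ha => exact h a ha
    | algebraMap c =>
      intro m hm
      rw [← Algebra.smul_def]
      exact M.smul_mem c hm
    | add a b _ _ iha ihb =>
      intro m hm
      rw [add_mul]
      exact add_mem (iha m hm) (ihb m hm)
    | mul a b _ _ iha ihb =>
      intro m hm
      rw [mul_assoc]
      exact iha _ (ihb m hm)
  exact eq_top_iff.mpr fun a _ => by simpa using key a 1 h1

/-- The pairs `(i, j)` with `1 ≤ i < j ≤ n + 1`, in lexicographic order. -/
def rootPairs (n : ℕ) : List (ℕ × ℕ) :=
  (List.range n).flatMap fun i' => (List.range (n - i')).map fun d => (i' + 1, i' + 2 + d)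

theorem mem_rootPairs {n i j : ℕ} :
    (i, j) ∈ rootPairs n ↔ 1 ≤ i ∧ i < j ∧ j ≤ n + 1 := by
  simp only [rootPairs, List.mem_flatMap, List.mem_map, List.mem_range, Prod.mk.injEq]
  constructor
  · rintro ⟨a, ha, d, hd, rfl, rfl⟩
    omega
  · rintro ⟨hi, hij, hj⟩
    exact ⟨i - 1, by omega, j - i - 1, by omega, by omega, by omega⟩

theorem nodup_rootPairs (n : ℕ) : (rootPairs n).Nodup := by
  refine List.nodup_flatMap.mpr ⟨fun a _ => ?_, ?_⟩
  · refine List.nodup_range.map fun d e h => ?_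
    have := congrArg Prod.snd h
    simpa using this
  · refine List.nodup_range.imp fun {a b} hab => ?_
    simp only [Function.onFun, List.disjoint_left, List.mem_map]
    rintro _ ⟨d, -, rfl⟩ ⟨e, -, h⟩
    have := congrArg Prod.fst h
    simp only at this
    omega


/-- Lemma `Lemma2.2.7`: if (R1), (R2), (R3) hold, `e_{i,j}^N = 0` for all `i < j`, and `R`
is generated as a `k`-algebra by `x₁,…,xₙ`, then `R` is spanned by the PBW monomials
`∏_{(i,j)} e_{i,j}^{ε_{i,j}}` (lexicographic order of the index pairs, `0 ≤ ε_{i,j} ≤ N−1`). -/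
theorem Lemma2_2_7 {k R : Type*} [Field k] [Ring R] [Algebra k R]
    (n N : ℕ) (hn : 1 ≤ n) (hN : 2 < N) (q : k) (hq : IsPrimitiveRoot q N)
    (qm : ℕ → ℕ → k)
    (hqne : ∀ i j, 1 ≤ i → i ≤ n → 1 ≤ j → j ≤ n → qm i j ≠ 0)
    (hdiag : ∀ i, 1 ≤ i → i ≤ n → qm i i = q)
    (hadj : ∀ i j, 1 ≤ i → i ≤ n → 1 ≤ j → j ≤ n → (i = j + 1 ∨ j = i + 1) →
      qm i j * qm j i = q⁻¹)
    (hfar : ∀ i j, 1 ≤ i → i ≤ n → 1 ≤ j → j ≤ n → (i + 2 ≤ j ∨ j + 2 ≤ i) →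
      qm i j * qm j i = 1)
    (x : ℕ → R)
    (R1 : ∀ i p, 1 ≤ i → i < p → p ≤ n → i + 2 ≤ p →
      x i * x p = qm i p • (x p * x i))
    (R2 : ∀ i, 1 ≤ i → i < n →
      ee qm x i (i+1) * ee qm x i (i+2)
        = Bq qm i (i+1) i (i+2) • (ee qm x i (i+2) * ee qm x i (i+1)))
    (R3 : ∀ i, 1 ≤ i → i < n →
      ee qm x i (i+2) * ee qm x (i+1) (i+2)
        = Bq qm i (i+2) (i+1) (i+2) • (ee qm x (i+1) (i+2) * ee qm x i (i+2)))
    (hpow : ∀ i j, 1 ≤ i → i < j → j ≤ n + 1 → ee qm x i j ^ N = 0)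
    (hgen : Algebra.adjoin k {a : R | ∃ i, 1 ≤ i ∧ i ≤ n ∧ a = x i} = ⊤)
    : Submodule.span k
      {m : R | ∃ ε : ℕ → ℕ → ℕ,
        (∀ i j, 1 ≤ i → i < j → j ≤ n + 1 → ε i j ≤ N - 1) ∧
        m = (((List.range n).flatMap fun i' =>
              (List.range (n - i')).map fun d => (i' + 1, i' + 2 + d)).map
              fun pq : ℕ × ℕ => ee qm x pq.1 pq.2 ^ ε pq.1 pq.2).prod}
      = ⊤ := by
  have hq1 : q + 1 ≠ 0 := by
    intro h
    have hq2 : q ^ 2 = 1 := by rw [eq_neg_of_add_eq_zero_left h]; norm_num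
    have := Nat.le_of_dvd two_pos (hq.dvd_of_pow_eq_one 2 hq2)
    omega
  let e : ℕ × ℕ → R := fun pq => ee qm x pq.1 pq.2
  have hM : ((rootPairs n).map fun pq => powerSpan k (e pq)).prod
      = ((List.range n).map fun a => ((List.range (n - a)).map fun d =>
            powerSpan k (ee qm x (a + 1) (a + 2 + d))).prod).prod := by
    simp only [rootPairs, List.map_flatMap, List.map_map]
    rw [List.flatMap, List.prod_flatten, List.map_map]
    rfl
  have htop : ((rootPairs n).map fun pq => powerSpan k (e pq)).prod = ⊤ := by
    refine Submodule.eq_top_of_adjoin_eq_top hgen (Submodule.one_le.mp ?_) ?_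
    · refine List.prod_induction (1 ≤ ·) (fun _ _ => one_le_mul) le_rfl fun P hP => ?_
      obtain ⟨pq, -, rfl⟩ := List.mem_map.mp hP
      exact one_le_powerSpan _
    · rintro _ ⟨i, hi, hin, rfl⟩ m hm
      rw [hM] at hm ⊢
      exact span_one_pair_mul_rows_le hqne R1 R2 R3 hdiag hq1 hi hin
        (Submodule.mul_mem_mul (Submodule.subset_span (by simp)) hm)
  rw [eq_top_iff, ← htop]
  refine (prod_powerSpan_le_span e (nodup_rootPairs n)).trans (Submodule.span_le.mpr ?_)
  rintro _ ⟨ε, rfl⟩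
  by_cases hε : ∀ i j, 1 ≤ i → i < j → j ≤ n + 1 → ε (i, j) ≤ N - 1
  · exact Submodule.subset_span ⟨fun i j => ε (i, j), hε, rfl⟩
  · push Not at hε
    obtain ⟨i, j, hi, hij, hj, hlt⟩ := hε
    have h0 : ((rootPairs n).map fun pq => e pq ^ ε pq).prod = 0 := by
      refine List.prod_eq_zero (List.mem_map.mpr ⟨(i, j), mem_rootPairs.mpr ⟨hi, hij, hj⟩, ?_⟩)
      exact pow_eq_zero_of_le (by omega) (hpow i j hi hij hj)
    rw [h0]
    exact zero_mem _
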